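/- (i) The commutator subgroup of H∞ is a dense subgroup of the rotation group SO(4,ℝ). (ii) H∞ is dense in the orthogonal group O(4,ℝ). (iii) Σ is dense in the unit sphere 𝒮 of ℝ⁴. -/

import Mathlib

noncomputable section

/-- The golden ratio τ = (1+√5)/2. -/
def gr : ℝ := (1 + Real.sqrt 5) / 2

/-- The H₄ root system with parameter t (t = τ gives Δ, t = 1-τ = τ' gives Δ'). -/
def DeltaSet (t : ℝ) : Set (Fin 4 → ℝ) :=
  {x | (∃ i, (x i = 1 ∨ x i = -1) ∧ ∀ j, j ≠ i → x j = 0)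
    ∨ (∀ i, x i = 1/2 ∨ x i = -1/2)
    ∨ (∃ σ : Equiv.Perm (Fin 4), Equiv.Perm.sign σ = 1 ∧
        ∃ ε : Fin 4 → ℝ, (∀ i, ε i = 1 ∨ ε i = -1) ∧
          ∀ i, x i = ε i * (![0, 1, 1 - t, t] (σ i)) / 2)}

/-- The matrix of the reflection `x ↦ x - 2(x·a)a` in the standard basis. -/
def reflMat (a : Fin 4 → ℝ) : Matrix (Fin 4) (Fin 4) ℝ :=
  Matrix.of fun i j => (if i = j then (1 : ℝ) else 0) - 2 * a i * a j

/-- The orthogonal group O(4,ℝ) as the matrix orthogonal group. -/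
abbrev OG4 := Matrix.orthogonalGroup (Fin 4) ℝ

/-- H∞, the subgroup of O(4,ℝ) generated by the reflections in the roots of Δ ∪ Δ'. -/
def HinfG : Subgroup OG4 :=
  Subgroup.closure {g : OG4 |
    ∃ a ∈ DeltaSet gr ∪ DeltaSet (1 - gr), (g : Matrix (Fin 4) (Fin 4) ℝ) = reflMat a}

/-- SO(4,ℝ) inside O(4,ℝ). -/
def SO4set : Set OG4 := {g | Matrix.det (g : Matrix (Fin 4) (Fin 4) ℝ) = 1}

/-- Σ, the orbit of Δ ∪ Δ' under H∞. -/
def SigmaSet : Set (Fin 4 → ℝ) :=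
  {x | ∃ g ∈ HinfG, ∃ a ∈ DeltaSet gr ∪ DeltaSet (1 - gr),
    x = Matrix.mulVec (g : Matrix (Fin 4) (Fin 4) ℝ) a}

open Matrix

section Reflections

variable {n : Type*} [Fintype n] [DecidableEq n]

/-- The reflection in the hyperplane orthogonal to `x`, as an orthogonal matrix; it is the identity
for `x = 0`. -/
def orthRefl (x : n → ℝ) : orthogonalGroup n ℝ :=
  ⟨1 - (2 / (x ⬝ᵥ x)) • vecMulVec x x, by
    rw [mem_orthogonalGroup_iff, transpose_sub, transpose_smul, transpose_vecMulVec, transpose_one,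
      sub_mul, mul_sub, mul_sub, smul_mul_smul_comm, vecMulVec_mul_vecMulVec, vecMulVec_smul,
      smul_smul]
    rcases eq_or_ne x 0 with rfl | hx
    · simp
    have h : x ⬝ᵥ x ≠ 0 := fun h => hx (dotProduct_self_eq_zero.1 h)
    rw [show 2 / (x ⬝ᵥ x) * (2 / (x ⬝ᵥ x)) * (x ⬝ᵥ x) = 2 / (x ⬝ᵥ x) + 2 / (x ⬝ᵥ x) by
      field_simp; norm_num, add_smul]
    simp only [mul_one, one_mul]
    abel⟩

theorem coe_orthRefl (x : n → ℝ) :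
    (orthRefl x : Matrix n n ℝ) = 1 - (2 / (x ⬝ᵥ x)) • vecMulVec x x := rfl

theorem orthRefl_mulVec (c x : n → ℝ) :
    (orthRefl c : Matrix n n ℝ) *ᵥ x = x - (2 * (c ⬝ᵥ x) / (c ⬝ᵥ c)) • c := by
  ext i
  simp [coe_orthRefl, sub_mulVec, smul_mulVec, vecMulVec_mulVec]
  ring

theorem det_orthRefl {x : n → ℝ} (hx : x ≠ 0) : (orthRefl x : Matrix n n ℝ).det = -1 := by
  have h : x ⬝ᵥ x ≠ 0 := fun h => hx (dotProduct_self_eq_zero.1 h)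
  rw [coe_orthRefl, ← smul_vecMulVec, vecMulVec_eq Unit, det_one_sub_mul_comm, det_unique]
  simp [replicateRow_mul_replicateCol_apply]
  field_simp
  norm_num

theorem orthRefl_smul {k : ℝ} (hk : k ≠ 0) (x : n → ℝ) : orthRefl (k • x) = orthRefl x := by
  apply Subtype.ext
  rw [coe_orthRefl, coe_orthRefl]
  congr 1
  ext i j
  rcases eq_or_ne x 0 with rfl | hx
  · simp
  have h : x ⬝ᵥ x ≠ 0 := fun h => hx (dotProduct_self_eq_zero.1 h)
  simp [vecMulVec_apply]
  field_simp

theorem orthRefl_mul_self (x : n → ℝ) : orthRefl x * orthRefl x = 1 := by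
  have h : (orthRefl x : Matrix n n ℝ)ᵀ = orthRefl x := by
    rw [coe_orthRefl, transpose_sub, transpose_smul, transpose_vecMulVec, transpose_one]
  apply Subtype.ext
  have := (mem_orthogonalGroup_iff n ℝ).1 (orthRefl x).2
  rw [h] at this
  simpa using this

theorem orthRefl_inv (x : n → ℝ) : (orthRefl x)⁻¹ = orthRefl x :=
  inv_eq_of_mul_eq_one_left (orthRefl_mul_self x)

theorem dotProduct_orthogonal_mulVec (g : orthogonalGroup n ℝ) (x y : n → ℝ) :
    ((g : Matrix n n ℝ) *ᵥ x) ⬝ᵥ ((g : Matrix n n ℝ) *ᵥ y) = x ⬝ᵥ y := by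
  rw [dotProduct_mulVec, ← mulVec_transpose, mulVec_mulVec, (mem_orthogonalGroup_iff' n ℝ).1 g.2,
    one_mulVec]

theorem orthRefl_orthogonal_mulVec (g : orthogonalGroup n ℝ) (x : n → ℝ) :
    orthRefl ((g : Matrix n n ℝ) *ᵥ x) = g * orthRefl x * g⁻¹ := by
  apply Subtype.ext
  have h : ((g⁻¹ : orthogonalGroup n ℝ) : Matrix n n ℝ) = (g : Matrix n n ℝ)ᵀ := rfl
  rw [coe_orthRefl, dotProduct_orthogonal_mulVec]
  simp only [Submonoid.coe_mul, h, coe_orthRefl]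
  rw [mul_sub, sub_mul, mul_one, (mem_orthogonalGroup_iff n ℝ).1 g.2, mul_smul_comm, smul_mul_assoc,
    mul_vecMulVec, vecMulVec_mul, vecMul_transpose]

theorem orthRefl_orthRefl_mulVec (c x : n → ℝ) :
    orthRefl ((orthRefl c : Matrix n n ℝ) *ᵥ x) = orthRefl c * orthRefl x * orthRefl c := by
  rw [orthRefl_orthogonal_mulVec, orthRefl_inv]

theorem orthRefl_sub_mulVec {x y : n → ℝ} (h : x ⬝ᵥ x = y ⬝ᵥ y) :
    (orthRefl (x - y) : Matrix n n ℝ) *ᵥ x = y := by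
  rcases eq_or_ne (x - y) 0 with h0 | h0
  · rw [sub_eq_zero.1 h0]
    simp [coe_orthRefl]
  have h1 : (x - y) ⬝ᵥ (x - y) ≠ 0 := fun h => h0 (dotProduct_self_eq_zero.1 h)
  have h2 : 2 * ((x - y) ⬝ᵥ x) = (x - y) ⬝ᵥ (x - y) := by
    simp only [sub_dotProduct, dotProduct_sub, dotProduct_comm y x]
    linarith
  rw [orthRefl_mulVec, h2, div_self h1]
  simp

theorem toLp_orthRefl_mulVec (v x : EuclideanSpace ℝ n) :
    WithLp.toLp 2 ((orthRefl v.ofLp : Matrix n n ℝ) *ᵥ x.ofLp) = (ℝ ∙ v)ᗮ.reflection x := by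
  rw [Submodule.reflection_orthogonal_apply, Submodule.reflection_singleton_apply, orthRefl_mulVec]
  have h1 : inner ℝ v x = v.ofLp ⬝ᵥ x.ofLp := by
    rw [EuclideanSpace.inner_eq_star_dotProduct, dotProduct_comm]; simp
  have h2 : ((‖v‖ : ℝ) : ℝ) ^ 2 = v.ofLp ⬝ᵥ v.ofLp := by
    rw [← real_inner_self_eq_norm_sq, EuclideanSpace.inner_eq_star_dotProduct]; simp
  ext i
  simp only [RCLike.ofReal_real_eq_id, id, h1, h2]
  simp
  ring

/-- Every orthogonal matrix is a product of reflections. -/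
theorem orthogonal_induction {P : orthogonalGroup n ℝ → Prop} (one : P 1)
    (mul : ∀ x g, P g → P (orthRefl x * g)) (g : orthogonalGroup n ℝ) : P g := by
  have key : ∀ (l : List (EuclideanSpace ℝ n)) (g : orthogonalGroup n ℝ),
      (∀ x, (l.map fun v => (ℝ ∙ v)ᗮ.reflection).prod x =
        WithLp.toLp 2 ((g : Matrix n n ℝ) *ᵥ x.ofLp)) → P g := by
    intro l
    induction l with
    | nil =>
      intro g h
      convert one
      apply Subtype.ext
      apply Matrix.ext_of_mulVec_single
      intro i
      rw [OneMemClass.coe_one, one_mulVec]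
      exact (congrArg WithLp.ofLp (h (WithLp.toLp 2 (Pi.single i 1)))).symm
    | cons v l ih =>
      intro g h
      have := mul v.ofLp (orthRefl v.ofLp * g) (ih _ fun x => ?_)
      · rwa [← mul_assoc, orthRefl_mul_self, one_mul] at this
      · have h1 := congrArg (ℝ ∙ v)ᗮ.reflection (h x)
        rw [List.map_cons, List.prod_cons, LinearIsometryEquiv.coe_mul, Function.comp_apply,
          Submodule.reflection_reflection, ← toLp_orthRefl_mulVec] at h1
        rw [h1]
        simp [mulVec_mulVec]
  let f : EuclideanSpace ℝ n →ₗᵢ[ℝ] EuclideanSpace ℝ n :=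
    ⟨toEuclideanLin (g : Matrix n n ℝ), fun x => by
      rw [← sq_eq_sq₀ (norm_nonneg _) (norm_nonneg _), ← real_inner_self_eq_norm_sq,
        ← real_inner_self_eq_norm_sq, EuclideanSpace.inner_eq_star_dotProduct,
        EuclideanSpace.inner_eq_star_dotProduct]
      simpa using dotProduct_orthogonal_mulVec g x.ofLp x.ofLp⟩
  obtain ⟨l, -, hl⟩ := (f.toLinearIsometryEquiv rfl).reflections_generate_dim
  exact key l g fun x => by rw [← hl]; rfl

end Reflections

section PlaneRotations

variable {n : Type*} [Fintype n]

/-- The point at angle `θ` of the circle through the orthonormal vectors `p` and `q`. -/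
def circlePoint (p q : n → ℝ) (θ : ℝ) : n → ℝ := Real.cos θ • p + Real.sin θ • q

theorem circlePoint_dotProduct {p q : n → ℝ} (hp : p ⬝ᵥ p = 1) (hq : q ⬝ᵥ q = 1)
    (hpq : p ⬝ᵥ q = 0) (α β : ℝ) :
    circlePoint p q α ⬝ᵥ circlePoint p q β = Real.cos (α - β) := by
  simp only [circlePoint, add_dotProduct, dotProduct_add, smul_dotProduct, dotProduct_smul, hp, hq,
    hpq, dotProduct_comm q p, smul_eq_mul, Real.cos_sub]
  ring

theorem circlePoint_dotProduct_self {p q : n → ℝ} (hp : p ⬝ᵥ p = 1) (hq : q ⬝ᵥ q = 1)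
    (hpq : p ⬝ᵥ q = 0) (α : ℝ) :
    circlePoint p q α ⬝ᵥ circlePoint p q α = 1 := by
  rw [circlePoint_dotProduct hp hq hpq, sub_self, Real.cos_zero]

variable [DecidableEq n]

theorem orthRefl_mul_orthRefl_apply {x y : n → ℝ} (hx : x ⬝ᵥ x = 1) (hy : y ⬝ᵥ y = 1) (i j : n) :
    (orthRefl x * orthRefl y : Matrix n n ℝ) i j =
      (1 : Matrix n n ℝ) i j - 2 * (x i * x j) - 2 * (y i * y j) + 4 * (x ⬝ᵥ y) * (x i * y j) := by
  rw [coe_orthRefl, coe_orthRefl, hx, hy, sub_mul, mul_sub, mul_sub, smul_mul_smul_comm,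
    vecMulVec_mul_vecMulVec, vecMulVec_smul]
  simp [vecMulVec_apply]
  ring

/-- The product of two reflections in a plane depends only on the angle between their normals. -/
theorem orthRefl_circlePoint_add {p q : n → ℝ} (hp : p ⬝ᵥ p = 1) (hq : q ⬝ᵥ q = 1)
    (hpq : p ⬝ᵥ q = 0) (θ δ : ℝ) :
    orthRefl (circlePoint p q (θ + δ)) * orthRefl (circlePoint p q θ) =
      orthRefl (circlePoint p q δ) * orthRefl (circlePoint p q 0) := by
  have h1 := circlePoint_dotProduct_self hp hq hpq
  apply Subtype.ext
  ext i j
  simp only [Submonoid.coe_mul, orthRefl_mul_orthRefl_apply (h1 _) (h1 _),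
    circlePoint_dotProduct hp hq hpq]
  rw [add_sub_cancel_left, sub_zero]
  simp only [circlePoint, Pi.add_apply, Pi.smul_apply, smul_eq_mul, Real.cos_add, Real.sin_add,
    Real.cos_zero, Real.sin_zero]
  have h2 := Real.sin_sq_add_cos_sq θ
  have h3 := Real.sin_sq_add_cos_sq δ
  grind

theorem continuous_orthRefl_circlePoint {p q : n → ℝ} (hp : p ⬝ᵥ p = 1) (hq : q ⬝ᵥ q = 1)
    (hpq : p ⬝ᵥ q = 0) :
    Continuous fun θ => orthRefl (circlePoint p q θ) := by
  refine Continuous.subtype_mk ?_ _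
  simp only [circlePoint_dotProduct_self hp hq hpq]
  refine continuous_matrix fun i j => ?_
  simp only [circlePoint, Matrix.sub_apply, Matrix.smul_apply, vecMulVec_apply,
    Pi.add_apply, Pi.smul_apply]
  fun_prop

/-- Two vectors at an angle with cosine `-1/4` generate, by reflections, a dense group of rotations
of the plane that they span. -/
theorem orthRefl_mul_orthRefl_mem_of_dotProduct_eq {K : Subgroup (orthogonalGroup n ℝ)}
    (hK : IsClosed (K : Set (orthogonalGroup n ℝ))) {a b : n → ℝ} (ha : a ⬝ᵥ a = 1)
    (hb : b ⬝ᵥ b = 1) (hab : a ⬝ᵥ b = -1 / 4)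
    (hmem : orthRefl b * orthRefl a * (orthRefl b * orthRefl a) ∈ K)
    {s t s' t' : ℝ} (h : s • a + t • b ≠ 0) (h' : s' • a + t' • b ≠ 0) :
    orthRefl (s • a + t • b) * orthRefl (s' • a + t' • b) ∈ K := by
  have h15 : √(15 : ℝ) ^ 2 = 15 := Real.sq_sqrt (by norm_num)
  have h15' : √(15 : ℝ) ≠ 0 := by positivity
  obtain ⟨q, hq⟩ : ∃ q, q = (4 / √15) • (b + (1 / 4 : ℝ) • a) := ⟨_, rfl⟩
  have hb_eq : b = (-1 / 4 : ℝ) • a + (√15 / 4) • q := by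
    rw [hq, smul_smul, div_mul_div_comm, mul_comm (√15), div_self (by positivity)]
    module
  have haq : a ⬝ᵥ q = 0 := by
    simp only [hq, dotProduct_smul, dotProduct_add, ha, hab, smul_eq_mul]
    ring
  have hqq : q ⬝ᵥ q = 1 := by
    simp only [hq, dotProduct_smul, smul_dotProduct, add_dotProduct, dotProduct_add, ha, hb, hab,
      dotProduct_comm b a, smul_eq_mul]
    field_simp
    rw [h15]
    norm_num
  obtain ⟨φ, hφ⟩ : ∃ φ, φ = Real.arccos (-1 / 4) := ⟨_, rfl⟩
  have hcos : Real.cos φ = -1 / 4 := by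
    rw [hφ, Real.cos_arccos (by norm_num) (by norm_num)]
  have hsin : Real.sin φ = √15 / 4 := by
    rw [hφ, Real.sin_arccos, show (1 - (-1 / 4 : ℝ) ^ 2) = 15 / 4 ^ 2 by norm_num,
      Real.sqrt_div (by norm_num), Real.sqrt_sq (by norm_num)]
  have hbφ : b = circlePoint a q φ := by rw [circlePoint, hcos, hsin, ← hb_eq]
  have ha0 : a = circlePoint a q 0 := by simp [circlePoint]
  let G : AddSubgroup ℝ :=
    { carrier := {δ | orthRefl (circlePoint a q δ) * orthRefl (circlePoint a q 0) ∈ K}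
      zero_mem' := by simp [orthRefl_mul_self]
      add_mem' := by
        intro α β hα hβ
        have := K.mul_mem hβ hα
        rwa [← orthRefl_circlePoint_add ha hqq haq α β, mul_assoc,
          ← mul_assoc (orthRefl (circlePoint a q α)), orthRefl_mul_self, one_mul] at this
      neg_mem' := by
        intro α hα
        have := K.inv_mem hα
        rw [← orthRefl_circlePoint_add ha hqq haq (-α) α, neg_add_cancel, _root_.mul_inv_rev,
          orthRefl_inv, orthRefl_inv] at this
        exact this }
  have hG : IsClosed (G : Set ℝ) := hK.preimage
    ((continuous_orthRefl_circlePoint ha hqq haq).mul continuous_const)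
  have hφG : φ + φ ∈ G := by
    change _ ∈ K
    rwa [hbφ, congrArg orthRefl ha0, ← mul_assoc, ← orthRefl_circlePoint_add ha hqq haq φ φ,
      mul_assoc (orthRefl (circlePoint a q (φ + φ))), orthRefl_mul_self, mul_one] at hmem
  have hπG : Real.pi ∈ G := by
    change _ ∈ K
    have : circlePoint a q Real.pi = (-1 : ℝ) • circlePoint a q 0 := by simp [circlePoint]
    rw [this, orthRefl_smul (by norm_num), orthRefl_mul_self]
    exact K.one_mem
  have hirr : Irrational ((φ + φ) / Real.pi) := by
    rintro ⟨r, hr⟩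
    have h1 : φ = ((r / 2 : ℚ) : ℝ) * Real.pi := by
      push_cast
      rw [hr]
      field_simp
      ring
    have := niven ⟨r / 2, h1⟩ ⟨-1 / 4, by rw [hcos]; norm_num⟩
    rw [hcos] at this
    norm_num at this
  have hall : ∀ δ, δ ∈ G := by
    have h1 : Dense (G : Set ℝ) := (dense_addSubgroupClosure_pair_iff.2 hirr).mono
      ((AddSubgroup.closure_le G).2 (by rintro x (rfl | rfl) <;> assumption))
    intro δ
    have := h1 δ
    rwa [hG.closure_eq] at this
  have polar : ∀ s t : ℝ, s • a + t • b ≠ 0 →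
      ∃ θ, orthRefl (s • a + t • b) = orthRefl (circlePoint a q θ) := by
    intro s t h
    obtain ⟨z, hz⟩ : ∃ z : ℂ, z = ⟨s - t / 4, t * √15 / 4⟩ := ⟨_, rfl⟩
    have h1 : s • a + t • b = ‖z‖ • circlePoint a q z.arg := by
      rw [circlePoint, smul_add, smul_smul, smul_smul, Complex.norm_mul_cos_arg,
        Complex.norm_mul_sin_arg, hz, hb_eq]
      module
    refine ⟨z.arg, ?_⟩
    rw [h1, orthRefl_smul]
    intro h0
    rw [h0, zero_smul] at h1
    exact h h1
  obtain ⟨θ, hθ⟩ := polar s t h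
  obtain ⟨θ', hθ'⟩ := polar s' t' h'
  have := hall (θ - θ')
  change _ ∈ K at this
  rwa [← orthRefl_circlePoint_add ha hqq haq θ', add_sub_cancel, ← hθ, ← hθ'] at this

end PlaneRotations

section Spreading

variable {n : Type*} [Fintype n] [DecidableEq n]

/-- A set closed under the reflections in its own elements that contains a subspace `W` of
dimension at least two, together with a vector at angle `π / 4` with `W`, contains the subspace
spanned by `W` and that vector. -/
theorem add_smul_mem_of_reflection_closed {D : Set (n → ℝ)}
    (hD : ∀ c ∈ D, ∀ x ∈ D, (orthRefl c : Matrix n n ℝ) *ᵥ x ∈ D) {W : Submodule ℝ (n → ℝ)}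
    (hW : (W : Set (n → ℝ)) ⊆ D) (hperp : ∀ w ∈ W, ∃ w' ∈ W, w' ≠ 0 ∧ w ⬝ᵥ w' = 0)
    {v u : n → ℝ} (hv : ∀ w ∈ W, w ⬝ᵥ v = 0) (hu : u ∈ W) (huv : u ⬝ᵥ u = v ⬝ᵥ v)
    (hmem : u + v ∈ D) {w : n → ℝ} (hw : w ∈ W) (t : ℝ) : w + t • v ∈ D := by
  rcases eq_or_ne v 0 with rfl | hv0
  · simpa using hW hw
  have hvv : v ⬝ᵥ v ≠ 0 := fun h => hv0 (dotProduct_self_eq_zero.1 h)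
  obtain ⟨w₁, hw₁, hw₁0, hww₁⟩ := hperp w hw
  have hw₁w₁ : 0 < w₁ ⬝ᵥ w₁ := (dotProduct_self_star_nonneg w₁).lt_of_ne'
    fun h => hw₁0 (dotProduct_self_eq_zero.1 h)
  obtain ⟨w', hw', hww', hnorm⟩ : ∃ w' ∈ W, w ⬝ᵥ w' = 0 ∧ w' ⬝ᵥ w' = v ⬝ᵥ v := by
    refine ⟨√((v ⬝ᵥ v) / (w₁ ⬝ᵥ w₁)) • w₁, W.smul_mem _ hw₁, by simp [hww₁], ?_⟩
    have h0 : 0 ≤ (v ⬝ᵥ v) / (w₁ ⬝ᵥ w₁) := div_nonneg (dotProduct_self_star_nonneg v) hw₁w₁.le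
    rw [smul_dotProduct, dotProduct_smul, smul_eq_mul, smul_eq_mul, ← mul_assoc,
      Real.mul_self_sqrt h0, div_mul_cancel₀ _ hw₁w₁.ne']
  have hmem' : w' + v ∈ D := by
    have h1 : (orthRefl (u - w') : Matrix n n ℝ) *ᵥ u = w' :=
      orthRefl_sub_mulVec (huv.trans hnorm.symm)
    have h2 : (orthRefl (u - w') : Matrix n n ℝ) *ᵥ v = v := by
      rw [orthRefl_mulVec, hv _ (W.sub_mem hu hw')]
      simp
    have := hD _ (hW (W.sub_mem hu hw')) _ hmem
    rwa [mulVec_add, h1, h2] at this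
  have hstep : (orthRefl (w' + v) : Matrix n n ℝ) *ᵥ (w - t • w') = w + t • v := by
    have h1 : (w' + v) ⬝ᵥ (w - t • w') = -(t * (v ⬝ᵥ v)) := by
      simp only [add_dotProduct, dotProduct_sub, dotProduct_smul, dotProduct_comm w' w, hww', hnorm,
        dotProduct_comm v, hv _ hw, hv _ hw', smul_eq_mul]
      ring
    have h2 : (w' + v) ⬝ᵥ (w' + v) = 2 * (v ⬝ᵥ v) := by
      simp only [add_dotProduct, dotProduct_add, hnorm, dotProduct_comm v w', hv _ hw']
      ring
    rw [orthRefl_mulVec, h1, h2, show 2 * -(t * (v ⬝ᵥ v)) / (2 * (v ⬝ᵥ v)) = -t by field_simp]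
    module
  rw [← hstep]
  exact hD _ hmem' _ (hW (W.sub_mem hw (W.smul_mem t hw')))

/-- The vectors `x` for which the reflections in `x` and `e` agree modulo `K`. -/
def reflClass (K : Subgroup (orthogonalGroup n ℝ)) (e : n → ℝ) : Set (n → ℝ) :=
  {x | x ≠ 0 → orthRefl x * orthRefl e ∈ K}

theorem orthRefl_mul_orthRefl_trans {K : Subgroup (orthogonalGroup n ℝ)} {x y z : n → ℝ}
    (h₁ : orthRefl x * orthRefl y ∈ K) (h₂ : orthRefl y * orthRefl z ∈ K) :
    orthRefl x * orthRefl z ∈ K := by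
  have := K.mul_mem h₁ h₂
  rwa [mul_assoc, ← mul_assoc (orthRefl y), orthRefl_mul_self, one_mul] at this

theorem orthRefl_mul_orthRefl_symm {K : Subgroup (orthogonalGroup n ℝ)} {x y : n → ℝ}
    (h : orthRefl x * orthRefl y ∈ K) : orthRefl y * orthRefl x ∈ K := by
  have := K.inv_mem h
  rwa [_root_.mul_inv_rev, orthRefl_inv, orthRefl_inv] at this

theorem orthRefl_mulVec_mem_reflClass {K : Subgroup (orthogonalGroup n ℝ)} {e c x : n → ℝ}
    (hc : c ∈ reflClass K e) (hx : x ∈ reflClass K e) :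
    (orthRefl c : Matrix n n ℝ) *ᵥ x ∈ reflClass K e := by
  rcases eq_or_ne c 0 with rfl | hc0
  · simpa [orthRefl_mulVec] using hx
  rcases eq_or_ne x 0 with rfl | hx0
  · simpa using hx
  intro _
  rw [orthRefl_orthRefl_mulVec]
  have := K.mul_mem (K.mul_mem (hc hc0) (orthRefl_mul_orthRefl_symm (hx hx0))) (hc hc0)
  rwa [mul_assoc (orthRefl c), ← mul_assoc (orthRefl e), orthRefl_mul_self, one_mul, ← mul_assoc]
    at this

/-- If `K` contains the products of any two reflections, then it has index at most two. -/
theorem mem_or_orthRefl_mul_mem {K : Subgroup (orthogonalGroup n ℝ)} {e : n → ℝ} (he : e ≠ 0)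
    (hK : ∀ x y : n → ℝ, x ≠ 0 → y ≠ 0 → orthRefl x * orthRefl y ∈ K) (g : orthogonalGroup n ℝ) :
    g ∈ K ∨ orthRefl e * g ∈ K := by
  induction g using orthogonal_induction with
  | one => exact .inl K.one_mem
  | mul x g ih =>
    rcases eq_or_ne x 0 with rfl | hx
    · have : orthRefl (0 : n → ℝ) = 1 := Subtype.ext (by simp [coe_orthRefl])
      rwa [this, one_mul]
    rcases ih with h | h
    · right
      rw [← mul_assoc]
      exact K.mul_mem (hK e x he hx) h
    · left
      have := K.mul_mem (hK x e hx he) h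
      rwa [mul_assoc, ← mul_assoc (orthRefl e), orthRefl_mul_self, one_mul] at this

end Spreading

section IcosianGroup

theorem gr_sq : gr ^ 2 = gr + 1 := by
  have : √(5 : ℝ) ^ 2 = 5 := Real.sq_sqrt (by norm_num)
  rw [gr]
  linarith

theorem coe_orthRefl_of_unit {a : Fin 4 → ℝ} (ha : a ⬝ᵥ a = 1) :
    (orthRefl a : Matrix (Fin 4) (Fin 4) ℝ) = reflMat a := by
  ext i j
  simp [coe_orthRefl, ha, reflMat, vecMulVec_apply, Matrix.one_apply]
  ring

theorem orthRefl_mem_HinfG {a : Fin 4 → ℝ} (ha : a ⬝ᵥ a = 1)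
    (hmem : a ∈ DeltaSet gr ∪ DeltaSet (1 - gr)) : orthRefl a ∈ HinfG :=
  Subgroup.subset_closure ⟨a, hmem, coe_orthRefl_of_unit ha⟩

/-- The root with coordinates `½(0, ±1, ±(1 - t), ±t)`, permuted by `σ` and with signs `ε`. -/
def permRoot (σ : Equiv.Perm (Fin 4)) (ε : Fin 4 → ℝ) (t : ℝ) : Fin 4 → ℝ :=
  fun i => ε i * ![0, 1, 1 - t, t] (σ i) / 2

section PermRoot

variable {σ : Equiv.Perm (Fin 4)} {ε : Fin 4 → ℝ}

theorem permRoot_mem (hσ : Equiv.Perm.sign σ = 1) (hε : ∀ i, ε i = 1 ∨ ε i = -1) (t : ℝ) :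
    permRoot σ ε t ∈ DeltaSet t :=
  .inr (.inr ⟨σ, hσ, ε, hε, fun _ => rfl⟩)

theorem permRoot_dotProduct (hε : ∀ i, ε i = 1 ∨ ε i = -1) (s t : ℝ) :
    permRoot σ ε s ⬝ᵥ permRoot σ ε t = (1 + (1 - s) * (1 - t) + s * t) / 4 := by
  have hsum := Equiv.sum_comp σ fun j => ![0, 1, 1 - s, s] j * ![0, 1, 1 - t, t] j / 4
  rw [Fin.sum_univ_four (fun j => ![0, 1, 1 - s, s] j * ![0, 1, 1 - t, t] j / 4)] at hsum
  calc permRoot σ ε s ⬝ᵥ permRoot σ ε t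
      = ∑ i, ![0, 1, 1 - s, s] (σ i) * ![0, 1, 1 - t, t] (σ i) / 4 := by
        refine Finset.sum_congr rfl fun i _ => ?_
        have : ε i * ε i = 1 := by rcases hε i with h | h <;> rw [h] <;> norm_num
        simp only [permRoot]
        linear_combination (![0, 1, 1 - s, s] (σ i) * ![0, 1, 1 - t, t] (σ i) / 4) * this
    _ = _ := by
        rw [hsum]
        simp
        ring

/-- The plane spanned by the roots of type `permRoot σ ε` for the golden ratio and for its
conjugate. -/
theorem exists_eq_smul_permRoot (hε : ∀ i, ε i = 1 ∨ ε i = -1) {x : Fin 4 → ℝ}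
    (h0 : x (σ.symm 0) = 0)
    (h1 : ε (σ.symm 1) * x (σ.symm 1) = ε (σ.symm 2) * x (σ.symm 2) + ε (σ.symm 3) * x (σ.symm 3)) :
    ∃ s t : ℝ, x = s • permRoot σ ε gr + t • permRoot σ ε (1 - gr) := by
  have hgr : gr = (1 + √5) / 2 := rfl
  have h5 : √(5 : ℝ) ^ 2 = 5 := Real.sq_sqrt (by norm_num)
  have h5' : √(5 : ℝ) ≠ 0 := by positivity
  have hεε : ∀ i, ε i * ε i = 1 := fun i => by rcases hε i with h | h <;> rw [h] <;> norm_num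
  obtain ⟨y, hy⟩ : ∃ y : Fin 4 → ℝ, y = fun j => ε (σ.symm j) * x (σ.symm j) := ⟨_, rfl⟩
  have hx : ∀ j, x (σ.symm j) = ε (σ.symm j) * y j := fun j => by
    rw [hy, ← mul_assoc, hεε, one_mul]
  have hy0 : y 0 = 0 := by simp [hy, h0]
  have hy1 : y 1 = y 2 + y 3 := by simpa [hy] using h1
  refine ⟨y 1 - (y 2 - y 3) / √5, y 1 + (y 2 - y 3) / √5, funext fun i => ?_⟩
  obtain ⟨j, rfl⟩ := σ.symm.surjective i
  rw [hx]
  simp only [Pi.add_apply, Pi.smul_apply, permRoot, smul_eq_mul, Equiv.apply_symm_apply, hgr]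
  fin_cases j <;> simp [hy0, hy1] <;> field_simp <;> ring

end PermRoot

/-- The closure of the commutator subgroup of `HinfG`. -/
def commutatorClosure : Subgroup OG4 := (⁅HinfG, HinfG⁆ : Subgroup OG4).topologicalClosure

theorem orthRefl_mul_orthRefl_mem_of_plane (σ : Equiv.Perm (Fin 4)) (ε : Fin 4 → ℝ)
    (hσ : Equiv.Perm.sign σ = 1) (hε : ∀ i, ε i = 1 ∨ ε i = -1) {x y : Fin 4 → ℝ}
    (hx : x ≠ 0) (hy : y ≠ 0) (hx0 : x (σ.symm 0) = 0) (hy0 : y (σ.symm 0) = 0)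
    (hx1 : ε (σ.symm 1) * x (σ.symm 1) = ε (σ.symm 2) * x (σ.symm 2) + ε (σ.symm 3) * x (σ.symm 3))
    (hy1 : ε (σ.symm 1) * y (σ.symm 1) =
      ε (σ.symm 2) * y (σ.symm 2) + ε (σ.symm 3) * y (σ.symm 3)) :
    orthRefl x * orthRefl y ∈ commutatorClosure := by
  obtain ⟨s, t, rfl⟩ := exists_eq_smul_permRoot hε hx0 hx1
  obtain ⟨s', t', rfl⟩ := exists_eq_smul_permRoot hε hy0 hy1
  have ha : permRoot σ ε gr ⬝ᵥ permRoot σ ε gr = 1 := by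
    rw [permRoot_dotProduct hε]
    linear_combination gr_sq / 2
  have hb : permRoot σ ε (1 - gr) ⬝ᵥ permRoot σ ε (1 - gr) = 1 := by
    rw [permRoot_dotProduct hε]
    linear_combination gr_sq / 2
  refine orthRefl_mul_orthRefl_mem_of_dotProduct_eq (Subgroup.isClosed_topologicalClosure _) ha hb
    ?_ (Subgroup.le_topologicalClosure _ ?_) hx hy
  · rw [permRoot_dotProduct hε]
    linear_combination -gr_sq / 2
  · have := Subgroup.commutator_mem_commutator
      (orthRefl_mem_HinfG hb (.inr (permRoot_mem hσ hε _)))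
      (orthRefl_mem_HinfG ha (.inl (permRoot_mem hσ hε _)))
    rwa [commutatorElement_def, orthRefl_inv, orthRefl_inv, mul_assoc] at this

/-- The hyperplane `x 0 = 0`. -/
def coordHyperplane : Submodule ℝ (Fin 4 → ℝ) where
  carrier := {x | x 0 = 0}
  zero_mem' := rfl
  add_mem' := by simp +contextual
  smul_mem' := by simp +contextual

/-- The plane `x 0 = 0`, `x 1 = x 2 + x 3`. -/
def basePlane : Submodule ℝ (Fin 4 → ℝ) where
  carrier := {x | x 0 = 0 ∧ x 1 = x 2 + x 3}
  zero_mem' := by simp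
  add_mem' := by
    rintro x y ⟨hx, hx'⟩ ⟨hy, hy'⟩
    simp only [Set.mem_ofPred_eq, Pi.add_apply]
    constructor <;> linarith
  smul_mem' := by
    rintro c x ⟨hx, hx'⟩
    simp [hx, hx', mul_add]

theorem basePlane_subset :
    (basePlane : Set (Fin 4 → ℝ)) ⊆ reflClass commutatorClosure ![0, 1, 0, 1] := by
  rintro x ⟨hx0, hx1⟩ hx
  refine orthRefl_mul_orthRefl_mem_of_plane (Equiv.refl _) 1 Equiv.Perm.sign_refl (by simp) hx
    ?_ ?_ ?_ ?_ ?_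
  · exact fun h => by simpa using congrFun h 1
  all_goals simp [hx0, hx1]

theorem coordHyperplane_subset :
    (coordHyperplane : Set (Fin 4 → ℝ)) ⊆ reflClass commutatorClosure ![0, 1, 0, 1] := by
  obtain ⟨β, hβ⟩ : ∃ β : ℝ, 2 * β ^ 2 + β = 5 / 2 := by
    refine ⟨(-1 + √21) / 4, ?_⟩
    have : √(21 : ℝ) ^ 2 = 21 := Real.sq_sqrt (by norm_num)
    linear_combination this / 8
  intro x (hx : x 0 = 0)
  have key := add_smul_mem_of_reflection_closed
    (fun c hc y hy => orthRefl_mulVec_mem_reflClass hc hy)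
    basePlane_subset (v := ![0, -1, 1, 1]) (u := ![0, -1 / 2, β, -1 / 2 - β])
    (w := x - ((-x 1 + x 2 + x 3) / 3) • ![0, -1, 1, 1]) ?_ ?_ ?_ ?_ ?_ ?_
    ((-x 1 + x 2 + x 3) / 3)
  · rwa [sub_add_cancel] at key
  · rintro w ⟨hw0, hw1⟩
    by_cases h : w = 0
    · refine ⟨![0, 1, 0, 1], ⟨rfl, by simp⟩, fun h => by simpa using congrFun h 1, by simp [h]⟩
    · refine ⟨![0, w 2 - w 3, -w 3 - w 1, w 1 + w 2], ⟨rfl, by simp; ring⟩, fun h0 => h ?_, ?_⟩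
      · have e1 := congrFun h0 1
        have e2 := congrFun h0 2
        have e3 := congrFun h0 3
        simp at e1 e2 e3
        ext i
        fin_cases i <;> simp [hw0] <;> linarith
      · simp [dotProduct, Fin.sum_univ_four]
        ring
  · rintro w ⟨hw0, hw1⟩
    simp [dotProduct, Fin.sum_univ_four, hw1]
  · exact ⟨rfl, by simp⟩
  · simp [dotProduct, Fin.sum_univ_four]
    linear_combination hβ
  · intro h
    have hne : (![0, 0, 1, -1] : Fin 4 → ℝ) ≠ 0 := fun h => by simpa using congrFun h 2
    refine orthRefl_mul_orthRefl_trans (y := ![0, 0, 1, -1]) ?_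
      (basePlane_subset ⟨rfl, by simp⟩ hne)
    refine orthRefl_mul_orthRefl_mem_of_plane (Equiv.refl _) ![1, -1, 1, 1] Equiv.Perm.sign_refl ?_
      h hne ?_ ?_ ?_ ?_
    · intro i
      fin_cases i <;> simp
    all_goals simp
    ring
  · refine ⟨by simp [hx], ?_⟩
    simp
    ring

theorem mem_reflClass_commutatorClosure (x : Fin 4 → ℝ) :
    x ∈ reflClass commutatorClosure ![0, 1, 0, 1] := by
  have key := add_smul_mem_of_reflection_closed
    (fun c hc y hy => orthRefl_mulVec_mem_reflClass hc hy)
    coordHyperplane_subset (v := ![1, 0, 0, 0]) (u := ![0, -1, 0, 0])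
    (w := x - x 0 • ![1, 0, 0, 0]) ?_ ?_ ?_ ?_ ?_ ?_ (x 0)
  · rwa [sub_add_cancel] at key
  · intro w (hw : w 0 = 0)
    by_cases h : w 1 = 0
    · exact ⟨![0, 1, 0, 0], rfl, fun h => by simpa using congrFun h 1,
        by simp [dotProduct, Fin.sum_univ_four, h]⟩
    · refine ⟨![0, -w 2, w 1, 0], rfl, fun h0 => h (by simpa using congrFun h0 2), ?_⟩
      simp [dotProduct, Fin.sum_univ_four]
      ring
  · intro w (hw : w 0 = 0)
    simp [dotProduct, Fin.sum_univ_four, hw]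
  · exact rfl
  · simp [dotProduct, Fin.sum_univ_four]
  · intro h
    have h0 : (Equiv.swap (0 : Fin 4) 2 * Equiv.swap 1 3).symm 0 = 2 := by decide
    have h1 : (Equiv.swap (0 : Fin 4) 2 * Equiv.swap 1 3).symm 1 = 3 := by decide
    have h2 : (Equiv.swap (0 : Fin 4) 2 * Equiv.swap 1 3).symm 2 = 0 := by decide
    have h3 : (Equiv.swap (0 : Fin 4) 2 * Equiv.swap 1 3).symm 3 = 1 := by decide
    refine orthRefl_mul_orthRefl_mem_of_plane (Equiv.swap 0 2 * Equiv.swap 1 3) 1 (by decide)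
      (by simp) h (fun h => by simpa using congrFun h 1) ?_ ?_ ?_ ?_
    all_goals simp [h0, h1, h2, h3]
  · change (x - x 0 • ![1, 0, 0, 0] : Fin 4 → ℝ) 0 = 0
    simp

theorem orthRefl_mul_orthRefl_mem_commutatorClosure {x y : Fin 4 → ℝ} (hx : x ≠ 0) (hy : y ≠ 0) :
    orthRefl x * orthRefl y ∈ commutatorClosure :=
  orthRefl_mul_orthRefl_trans (mem_reflClass_commutatorClosure x hx)
    (orthRefl_mul_orthRefl_symm (mem_reflClass_commutatorClosure y hy))

theorem det_of_mem_commutatorClosure {g : OG4} (hg : g ∈ commutatorClosure) :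
    (g : Matrix (Fin 4) (Fin 4) ℝ).det = 1 := by
  let f : OG4 →* ℝ := detMonoidHom.comp (orthogonalGroup (Fin 4) ℝ).subtype
  have hf : Continuous f := Continuous.matrix_det
    (A := (Subtype.val : OG4 → Matrix (Fin 4) (Fin 4) ℝ)) continuous_subtype_val
  refine Subgroup.topologicalClosure_minimal (t := f.ker) _ ?_ (isClosed_singleton.preimage hf) hg
  rw [Subgroup.commutator_le]
  intro a _ b _
  rw [MonoidHom.mem_ker, commutatorElement_def, map_mul, map_mul, map_mul, mul_right_comm (f a),
    mul_assoc, ← map_mul, ← map_mul, mul_inv_cancel, mul_inv_cancel, map_one, mul_one]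

end IcosianGroup

theorem statement7 :
    (((⁅HinfG, HinfG⁆ : Subgroup OG4) : Set OG4) ⊆ SO4set ∧
      SO4set ⊆ closure ((⁅HinfG, HinfG⁆ : Subgroup OG4) : Set OG4)) ∧
    Dense (HinfG : Set OG4) ∧
    (∀ x : Fin 4 → ℝ, (∑ i, x i ^ 2) = 1 → ∀ ε > 0, ∃ y ∈ SigmaSet,
      Real.sqrt (∑ i, (x i - y i) ^ 2) < ε) := by
  obtain ⟨e, he_def⟩ : ∃ e : Fin 4 → ℝ, e = ![1, 0, 0, 0] := ⟨_, rfl⟩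
  have he : e ⬝ᵥ e = 1 := by simp [he_def]
  have he0 : e ≠ 0 := fun h => by simp [h] at he
  have he_mem : e ∈ DeltaSet gr ∪ DeltaSet (1 - gr) :=
    .inl (.inl ⟨0, .inl (by simp [he_def]), fun j hj => by fin_cases j <;> simp_all⟩)
  have heH : orthRefl e ∈ HinfG := orthRefl_mem_HinfG he he_mem
  have hcases := mem_or_orthRefl_mul_mem he0 fun x y hx hy =>
    orthRefl_mul_orthRefl_mem_commutatorClosure hx hy
  have hdense : Dense (HinfG : Set OG4) := by
    have hle : commutatorClosure ≤ HinfG.topologicalClosure :=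
      Subgroup.topologicalClosure_mono (Subgroup.commutator_le_self HinfG)
    intro g
    change g ∈ HinfG.topologicalClosure
    rcases hcases g with h | h
    · exact hle h
    · have := mul_mem (HinfG.le_topologicalClosure heH) (hle h)
      rwa [← mul_assoc, orthRefl_mul_self, one_mul] at this
  refine ⟨⟨fun g hg => det_of_mem_commutatorClosure (Subgroup.le_topologicalClosure _ hg),
    fun g hg => ?_⟩, hdense, fun x hx ε hε => ?_⟩
  · rcases hcases g with h | h
    · exact h
    · have hdet := det_of_mem_commutatorClosure h
      rw [Submonoid.coe_mul, det_mul, show (g : Matrix (Fin 4) (Fin 4) ℝ).det = 1 from hg, mul_one,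
        det_orthRefl he0] at hdet
      norm_num at hdet
  · have hxx : e ⬝ᵥ e = x ⬝ᵥ x := by
      rw [he, ← hx]
      simp [dotProduct, sq]
    let F : OG4 → ℝ := fun g => √(∑ i, (x i - ((g : Matrix (Fin 4) (Fin 4) ℝ) *ᵥ e) i) ^ 2)
    have hF : Continuous F := by
      refine Real.continuous_sqrt.comp (continuous_finsetSum _ fun i _ => ?_)
      refine (continuous_const.sub ?_).pow 2
      exact (continuous_apply i).comp (continuous_subtype_val.matrix_mulVec continuous_const)
    obtain ⟨g, hg, hgε⟩ := hdense.exists_mem_open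
      (isOpen_Iio.preimage hF : IsOpen (F ⁻¹' Set.Iio ε))
      ⟨orthRefl (e - x), by simpa [F, orthRefl_sub_mulVec hxx] using hε⟩
    exact ⟨_, ⟨g, hg, e, he_mem, rfl⟩, hgε⟩
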